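/- Fix F ≥ 1, D ≥ 1, a decision function σ, and inputs x_i, x_j ∈ ℝ^F. Then the empirical NTK at the NTK initialization of an ensemble of M soft rule sets of depth D, Θ̂₀^M(x_i,x_j), converges in probability as M → ∞ to the deterministic value Θ^{(D,Rule)}(x_i,x_j) = D·Σ(x_i,x_j)·T(x_i,x_j)^{D−1}·Ṫ(x_i,x_j) + T(x_i,x_j)^D. -/

import Mathlib

open MeasureTheory ProbabilityTheory Filter

noncomputable section

/-- Euclidean inner product on `ℝ^F`. -/
def dot {F : ℕ} (u x : Fin F → ℝ) : ℝ := ∑ k, u k * x k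

/-- Standard Gaussian measure on `ℝ^F` (zero mean, identity covariance). -/
def stdGauss (F : ℕ) : Measure (Fin F → ℝ) := Measure.pi fun _ => gaussianReal 0 1

/-- `T(x_i,x_j) = E[σ(uᵀx_i)·σ(uᵀx_j)]` for `u` standard Gaussian. -/
def Tker {F : ℕ} (σ : ℝ → ℝ) (xi xj : Fin F → ℝ) : ℝ :=
  ∫ u, σ (dot u xi) * σ (dot u xj) ∂ stdGauss F

/-- `Ṫ(x_i,x_j) = E[σ̇(uᵀx_i)·σ̇(uᵀx_j)]` for `u` standard Gaussian. -/
def Tdot {F : ℕ} (σ : ℝ → ℝ) (xi xj : Fin F → ℝ) : ℝ :=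
  ∫ u, deriv σ (dot u xi) * deriv σ (dot u xj) ∂ stdGauss F

/-- A decision function: differentiable with bounded derivative, values in [0,1],
and `σ(p) + σ(−p) = 1`. -/
structure IsDecisionFunc (σ : ℝ → ℝ) : Prop where
  differentiable : Differentiable ℝ σ
  deriv_bounded : ∃ C : ℝ, ∀ p : ℝ, |deriv σ p| ≤ C
  mem_Icc : ∀ p : ℝ, σ p ∈ Set.Icc (0:ℝ) 1
  symm : ∀ p : ℝ, σ p + σ (-p) = 1

/-- Index type for the scalar trainable parameters of a single depth-`D` soft rule set on
`ℝ^F`: one scalar per coordinate of each of the `D` weight vectors, plus the leaf scalar. -/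
abbrev RParam (D F : ℕ) : Type := (Fin D × Fin F) ⊕ Unit

/-- A soft rule set of depth `D`: `f(x; w, π) = π·∏_{n=1}^D σ(wₙᵀx)`. -/
def ruleF {F D : ℕ} (σ : ℝ → ℝ) (θ : RParam D F → ℝ) (x : Fin F → ℝ) : ℝ :=
  θ (Sum.inr ()) * ∏ n : Fin D, σ (dot (fun k => θ (Sum.inl (n, k))) x)

/-- An ensemble of `M` soft rule sets: `f^M(x) = (1/√M) ∑_m f(x; w_m, π_m)`. -/
def ruleEnsembleF {F D : ℕ} (σ : ℝ → ℝ) (M : ℕ) (θ : Fin M × RParam D F → ℝ)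
    (x : Fin F → ℝ) : ℝ :=
  (1 / Real.sqrt M) * ∑ m : Fin M, ruleF σ (fun p => θ (m, p)) x

/-- Partial derivative of `g` with respect to the scalar parameter indexed by `q`. -/
def pderiv {ι : Type} [DecidableEq ι] (g : (ι → ℝ) → ℝ) (θ : ι → ℝ) (q : ι) : ℝ :=
  deriv (fun s => g (Function.update θ q s)) (θ q)

/-- Empirical NTK of a model `g` with scalar parameters indexed by `ι`:
`Θ̂(x_i,x_j) = ∑_θ (∂g(x_i)/∂θ)·(∂g(x_j)/∂θ)`. -/
def empNTK {ι : Type} [Fintype ι] [DecidableEq ι] {F : ℕ}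
    (g : (ι → ℝ) → (Fin F → ℝ) → ℝ) (θ : ι → ℝ) (xi xj : Fin F → ℝ) : ℝ :=
  ∑ q : ι, pderiv (fun θ' => g θ' xi) θ q * pderiv (fun θ' => g θ' xj) θ q

/-- NTK initialization: all scalar parameters are i.i.d. standard Gaussian. -/
def initMeasure (ι : Type) [Fintype ι] : Measure (ι → ℝ) :=
  Measure.pi fun _ => gaussianReal 0 1

lemma mp_curry (α β : Type) [Fintype α] [Fintype β] :
    MeasurePreserving (fun (θ : α × β → ℝ) (i : α) (j : β) => θ (i, j))
      (initMeasure (α × β)) (Measure.pi fun _ : α => initMeasure β) := by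
  refine ⟨by fun_prop, ?_⟩
  have h := Measure.infinitePi_map_curry (ι := α) (κ := β) (fun _ _ => gaussianReal 0 1)
  simp only [Measure.infinitePi_eq_pi] at h
  exact h

instance initProb (ι : Type) [Fintype ι] : IsProbabilityMeasure (initMeasure ι) := by
  unfold initMeasure; infer_instance

lemma pderiv_ens {F D : ℕ} (σ : ℝ → ℝ) (M : ℕ) (θ : Fin M × RParam D F → ℝ)
    (x : Fin F → ℝ) (m : Fin M) (p : RParam D F) :
    pderiv (fun θ' => ruleEnsembleF σ M θ' x) θ (m, p) =
      (1 / Real.sqrt M) * pderiv (fun θ' => ruleF σ θ' x) (fun p => θ (m, p)) p := by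
  unfold pderiv ruleEnsembleF
  simp only
  rw [deriv_const_mul_field]
  congr 1
  have : (fun s => ∑ m' : Fin M, ruleF σ (fun p' => Function.update θ (m, p) s (m', p')) x) =
      fun s => (∑ m' ∈ Finset.univ.erase m, ruleF σ (fun p' => θ (m', p')) x) +
        ruleF σ (Function.update (fun p => θ (m, p)) p s) x := by
    funext s
    rw [← Finset.sum_erase_add _ _ (Finset.mem_univ m)]
    congr 1
    · refine Finset.sum_congr rfl fun m' hm' => ?_
      congr 1
      funext p'
      rw [Function.update_of_ne]
      intro h
      exact (Finset.ne_of_mem_erase hm') (congrArg Prod.fst h)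
    · congr 1
      funext p'
      by_cases h : p' = p
      · subst h; simp
      · rw [Function.update_of_ne h, Function.update_of_ne]
        intro h'; exact h (congrArg Prod.snd h')
  rw [this, deriv_const_add]

lemma empNTK_ens {F D : ℕ} (σ : ℝ → ℝ) (M : ℕ) (θ : Fin M × RParam D F → ℝ)
    (xi xj : Fin F → ℝ) :
    empNTK (ruleEnsembleF σ M) θ xi xj =
      (1 / (M : ℝ)) * ∑ m : Fin M, empNTK (ruleF σ) (fun p => θ (m, p)) xi xj := by
  unfold empNTK
  rw [Fintype.sum_prod_type, Finset.mul_sum]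
  refine Finset.sum_congr rfl fun m _ => ?_
  rw [Finset.mul_sum]
  refine Finset.sum_congr rfl fun p _ => ?_
  rw [pderiv_ens, pderiv_ens]
  have : (1 / Real.sqrt M) * (1 / Real.sqrt M) = 1 / (M : ℝ) := by
    rw [div_mul_div_comm, Real.mul_self_sqrt (Nat.cast_nonneg M), one_mul]
  rw [← this]; ring

lemma pderiv_inr {F D : ℕ} (σ : ℝ → ℝ) (θ : RParam D F → ℝ) (x : Fin F → ℝ) :
    pderiv (fun θ' => ruleF σ θ' x) θ (Sum.inr ()) =
      ∏ n : Fin D, σ (dot (fun k => θ (Sum.inl (n, k))) x) := by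
  unfold pderiv ruleF
  simp

lemma hasDerivAt_dot {F : ℕ} (u x : Fin F → ℝ) (k : Fin F) (s : ℝ) :
    HasDerivAt (fun s => dot (Function.update u k s) x) (x k) s := by
  have : (fun s => dot (Function.update u k s) x) =
      fun s => (∑ k' ∈ Finset.univ.erase k, u k' * x k') + s * x k := by
    funext s
    unfold dot
    rw [← Finset.sum_erase_add _ _ (Finset.mem_univ k)]
    congr 1
    · refine Finset.sum_congr rfl fun k' hk' => ?_
      rw [Function.update_of_ne (Finset.ne_of_mem_erase hk')]
    · simp
  rw [this]
  simpa using ((hasDerivAt_id s).mul_const (x k)).const_add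
    (∑ k' ∈ Finset.univ.erase k, u k' * x k')

lemma pderiv_inl {F D : ℕ} (σ : ℝ → ℝ) (hσ : Differentiable ℝ σ) (θ : RParam D F → ℝ)
    (x : Fin F → ℝ) (n : Fin D) (k : Fin F) :
    pderiv (fun θ' => ruleF σ θ' x) θ (Sum.inl (n, k)) =
      θ (Sum.inr ()) * x k * ∏ n' : Fin D, (if n' = n then deriv σ else σ)
        (dot (fun k => θ (Sum.inl (n', k))) x) := by
  have h1 : (fun s => ruleF σ (Function.update θ (Sum.inl (n, k)) s) x) =
      fun s => (θ (Sum.inr ()) * ∏ n' ∈ Finset.univ.erase n,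
        σ (dot (fun k => θ (Sum.inl (n', k))) x)) *
        σ (dot (Function.update (fun k => θ (Sum.inl (n, k))) k s) x) := by
    funext s
    unfold ruleF
    rw [Function.update_of_ne (by simp), mul_assoc, ← Finset.prod_erase_mul _ _ (Finset.mem_univ n)]
    congr 2
    · refine Finset.prod_congr rfl fun n' hn' => ?_
      congr 2
      funext k'
      rw [Function.update_of_ne]
      intro h
      have := Sum.inl.inj h
      exact (Finset.ne_of_mem_erase hn') (congrArg Prod.fst this)
    · congr 2
      funext k'
      by_cases h : k' = k
      · subst h; simp
      · rw [Function.update_of_ne h, Function.update_of_ne]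
        intro h'; exact h (congrArg Prod.snd (Sum.inl.inj h'))
  unfold pderiv
  rw [h1, deriv_const_mul_field]
  have h2 := (hσ (dot (Function.update (fun k => θ (Sum.inl (n, k))) k
    (θ (Sum.inl (n, k)))) x)).hasDerivAt.comp (θ (Sum.inl (n, k)))
    (hasDerivAt_dot (fun k => θ (Sum.inl (n, k))) x k (θ (Sum.inl (n, k))))
  have h3 := h2.deriv
  rw [Function.comp_def] at h3
  rw [h3, Function.update_eq_self, ← Finset.prod_erase_mul _ _ (Finset.mem_univ n)]
  have h4 : ∏ n' ∈ Finset.univ.erase n, (if n' = n then deriv σ else σ)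
      (dot (fun k => θ (Sum.inl (n', k))) x) = ∏ n' ∈ Finset.univ.erase n,
        σ (dot (fun k => θ (Sum.inl (n', k))) x) :=
    Finset.prod_congr rfl fun n' hn' => by rw [if_neg (Finset.ne_of_mem_erase hn')]
  rw [h4, if_pos rfl]
  ring

/-- the row factor -/
def rowH {F D : ℕ} (σ : ℝ → ℝ) (xi xj : Fin F → ℝ) (n n' : Fin D) (u : Fin F → ℝ) : ℝ :=
  (if n' = n then deriv σ else σ) (dot u xi) * (if n' = n then deriv σ else σ) (dot u xj)

lemma empNTK_rule {F D : ℕ} (σ : ℝ → ℝ) (hσ : Differentiable ℝ σ) (θ : RParam D F → ℝ)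
    (xi xj : Fin F → ℝ) :
    empNTK (ruleF σ) θ xi xj =
      (∑ n : Fin D, dot xi xj * (θ (Sum.inr ()) ^ 2 *
        ∏ n', rowH σ xi xj n n' (fun k => θ (Sum.inl (n', k))))) +
      ∏ n' : Fin D, (σ (dot (fun k => θ (Sum.inl (n', k))) xi) *
        σ (dot (fun k => θ (Sum.inl (n', k))) xj)) := by
  unfold empNTK
  rw [Fintype.sum_sum_type, Fintype.sum_prod_type]
  congr 1
  · refine Finset.sum_congr rfl fun n _ => ?_
    simp only [pderiv_inl σ hσ, rowH, Finset.prod_mul_distrib]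
    rw [dot, Finset.sum_mul]
    refine Finset.sum_congr rfl fun k _ => ?_
    ring
  · simp [pderiv_inr, Finset.prod_mul_distrib]

lemma integral_rows {F D : ℕ} (g : ℝ → ℝ) (h : Fin D → (Fin F → ℝ) → ℝ) :
    ∫ θ, g (θ (Sum.inr ())) * ∏ n, h n (fun k => θ (Sum.inl (n, k))) ∂ initMeasure (RParam D F) =
      (∫ t, g t ∂ gaussianReal 0 1) * ∏ n, ∫ u, h n u ∂ stdGauss F := by
  have h1 := measurePreserving_sumPiEquivProdPi_symm (ι := Fin D × Fin F) (ι' := Unit)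
    (X := fun _ => ℝ) (fun _ => gaussianReal 0 1)
  unfold initMeasure
  rw [← h1.integral_comp (MeasurableEquiv.measurableEmbedding _)]
  have h2 : ∀ z : (Fin D × Fin F → ℝ) × (Unit → ℝ),
    g ((MeasurableEquiv.sumPiEquivProdPi (fun _ : RParam D F => ℝ)).symm z (Sum.inr ())) *
      ∏ n, h n (fun k => (MeasurableEquiv.sumPiEquivProdPi (fun _ : RParam D F => ℝ)).symm z
        (Sum.inl (n, k))) = (∏ n, h n (fun k => z.1 (n, k))) * ∏ i : Unit, g (z.2 i) := by
    intro z
    rw [mul_comm]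
    simp [MeasurableEquiv.sumPiEquivProdPi, Equiv.sumPiEquivProdPi]
  simp_rw [h2]
  rw [integral_prod_mul (fun w : Fin D × Fin F → ℝ => ∏ n, h n (fun k => w (n, k)))
    (fun v : Unit → ℝ => ∏ i : Unit, g (v i)), mul_comm]
  rw [integral_fintype_prod_eq_prod (𝕜 := ℝ) (fun _ : Unit => g)]
  congr 1
  · simp
  · have h3 : MeasurePreserving (MeasurableEquiv.curry (Fin D) (Fin F) ℝ)
      (initMeasure (Fin D × Fin F)) (Measure.pi fun _ : Fin D => initMeasure (Fin F)) :=
      mp_curry (Fin D) (Fin F)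
    have h4 := h3.integral_comp (MeasurableEquiv.measurableEmbedding _) (fun w => ∏ n, h n (w n))
    rw [integral_fintype_prod_eq_prod (𝕜 := ℝ) h] at h4
    exact h4

lemma meas_dot {F : ℕ} (x : Fin F → ℝ) : Measurable (fun u : Fin F → ℝ => dot u x) := by
  unfold dot; fun_prop

lemma rowH_meas {F D : ℕ} (σ : ℝ → ℝ) (hσ : Differentiable ℝ σ) (xi xj : Fin F → ℝ)
    (n n' : Fin D) : Measurable (rowH σ xi xj n n') := by
  have h1 : Measurable (if n' = n then deriv σ else σ) := by
    split_ifs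
    · exact measurable_deriv σ
    · exact hσ.continuous.measurable
  exact (h1.comp (meas_dot xi)).mul (h1.comp (meas_dot xj))

lemma prod_rowH_bdd {F D : ℕ} (σ : ℝ → ℝ) (hσ : IsDecisionFunc σ) (xi xj : Fin F → ℝ)
    (n : Fin D) : ∃ B : ℝ, ∀ w : Fin D → Fin F → ℝ, |∏ n', rowH σ xi xj n n' (w n')| ≤ B := by
  obtain ⟨C, hC⟩ := hσ.deriv_bounded
  have h1 : ∀ n' p, |(if n' = n then deriv σ else σ) p| ≤ max C 1 := by
    intro n' p
    split_ifs
    · exact (hC p).trans (le_max_left _ _)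
    · have := hσ.mem_Icc p
      rw [abs_of_nonneg this.1]
      exact this.2.trans (le_max_right _ _)
  refine ⟨∏ _n' : Fin D, (max C 1 * max C 1), fun w => ?_⟩
  rw [Finset.abs_prod]
  refine Finset.prod_le_prod (fun _ _ => abs_nonneg _) fun n' _ => ?_
  rw [rowH, abs_mul]
  exact mul_le_mul (h1 _ _) (h1 _ _) (abs_nonneg _) ((abs_nonneg _).trans (h1 n' 0))

lemma memLp_gauss_mul {F D : ℕ} (b : (RParam D F → ℝ) → ℝ) (hb : Measurable b) (B : ℝ)
    (hB : ∀ θ, |b θ| ≤ B) (j : ℕ) :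
    MemLp (fun θ => θ (Sum.inr ()) ^ j * b θ) 2 (initMeasure (RParam D F)) := by
  have hmp : MeasurePreserving (fun θ : RParam D F → ℝ => θ (Sum.inr ()))
      (initMeasure (RParam D F)) (gaussianReal 0 1) :=
    measurePreserving_eval (fun _ : RParam D F => gaussianReal 0 1) (Sum.inr ())
  have hi : Integrable (fun t : ℝ => t ^ (j * 2)) (gaussianReal 0 1) := by
    have h := (memLp_id_gaussianReal (μ := 0) (v := 1) ((j * 2 : ℕ) : NNReal))
    have h' := MemLp.integrable_norm_pow' (p := j * 2) (f := id) (by simpa using h)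
    refine (integrable_norm_iff (by fun_prop)).1 ?_
    simpa using h'
  have hm : Measurable (fun θ : RParam D F → ℝ => θ (Sum.inr ()) ^ j * b θ) := by fun_prop
  rw [memLp_two_iff_integrable_sq hm.aestronglyMeasurable]
  have h2 := (hmp.integrable_comp_of_integrable hi).mul_bdd (g := fun θ => b θ ^ 2) (c := B ^ 2)
    (by fun_prop) (ae_of_all _ fun θ => by
      rw [Real.norm_eq_abs, abs_pow]; exact pow_le_pow_left₀ (abs_nonneg _) (hB θ) 2)
  refine h2.congr (ae_of_all _ fun θ => ?_)
  simp only [Function.comp]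
  ring

lemma memLp_term {F D : ℕ} (σ : ℝ → ℝ) (hσ : IsDecisionFunc σ) (xi xj : Fin F → ℝ) (n : Fin D) :
    MemLp (fun θ : RParam D F → ℝ => dot xi xj * (θ (Sum.inr ()) ^ 2 *
        ∏ n', rowH σ xi xj n n' (fun k => θ (Sum.inl (n', k))))) 2 (initMeasure (RParam D F)) := by
  obtain ⟨B, hB⟩ := prod_rowH_bdd σ hσ xi xj n
  refine (memLp_gauss_mul _ ?_ B (fun θ => hB fun n' k => θ (Sum.inl (n', k))) 2).const_mul _
  refine Finset.measurable_prod _ fun n' _ => ?_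
  exact (rowH_meas σ hσ.differentiable xi xj n n').comp (by fun_prop)

lemma memLp_last {F D : ℕ} (σ : ℝ → ℝ) (hσ : IsDecisionFunc σ) (xi xj : Fin F → ℝ) :
    MemLp (fun θ : RParam D F → ℝ => ∏ n' : Fin D, (σ (dot (fun k => θ (Sum.inl (n', k))) xi) *
        σ (dot (fun k => θ (Sum.inl (n', k))) xj))) 2 (initMeasure (RParam D F)) := by
  have h := memLp_gauss_mul (F := F) (D := D) (fun θ => ∏ n' : Fin D,
    (σ (dot (fun k => θ (Sum.inl (n', k))) xi) * σ (dot (fun k => θ (Sum.inl (n', k))) xj)))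
    ?_ 1 ?_ 0
  · simpa using h
  · refine Finset.measurable_prod _ fun n' _ => ?_
    have hm := hσ.differentiable.continuous.measurable
    have hr : Measurable (fun (θ : RParam D F → ℝ) k => θ (Sum.inl (n', k))) := by fun_prop
    exact ((hm.comp (meas_dot xi)).comp hr).mul ((hm.comp (meas_dot xj)).comp hr)
  · intro θ
    rw [Finset.abs_prod]
    refine Finset.prod_le_one (fun _ _ => abs_nonneg _) fun n' _ => ?_
    have h1 := hσ.mem_Icc (dot (fun k => θ (Sum.inl (n', k))) xi)
    have h2 := hσ.mem_Icc (dot (fun k => θ (Sum.inl (n', k))) xj)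
    rw [abs_of_nonneg (mul_nonneg h1.1 h2.1)]
    exact mul_le_one₀ h1.2 h2.1 h2.2

lemma memLp_ntk {F D : ℕ} (σ : ℝ → ℝ) (hσ : IsDecisionFunc σ) (xi xj : Fin F → ℝ) :
    MemLp (fun θ : RParam D F → ℝ => empNTK (ruleF σ) θ xi xj) 2 (initMeasure (RParam D F)) := by
  simp_rw [empNTK_rule σ hσ.differentiable]
  exact (memLp_finset_sum _ fun n _ => memLp_term σ hσ xi xj n).add (memLp_last σ hσ xi xj)

lemma gauss_sq : ∫ t, t ^ 2 ∂ gaussianReal 0 1 = 1 := by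
  have h := variance_id_gaussianReal (μ := 0) (v := 1)
  rw [variance_of_integral_eq_zero (by fun_prop) (by simp)] at h
  simpa using h

lemma integral_ntk {F D : ℕ} (σ : ℝ → ℝ) (hσ : IsDecisionFunc σ) (xi xj : Fin F → ℝ) :
    ∫ θ, empNTK (ruleF σ) θ xi xj ∂ initMeasure (RParam D F) =
      (D : ℝ) * dot xi xj * (Tker σ xi xj)^(D-1) * Tdot σ xi xj + (Tker σ xi xj)^D := by
  simp_rw [empNTK_rule σ hσ.differentiable]
  have hint := fun n : Fin D => (memLp_term σ hσ xi xj n).integrable one_le_two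
  rw [integral_add (integrable_finset_sum _ fun n _ => hint n)
    ((memLp_last σ hσ xi xj).integrable one_le_two), integral_finset_sum _ fun n _ => hint n]
  congr 1
  · have : ∀ n : Fin D, ∫ θ, dot xi xj * (θ (Sum.inr ()) ^ 2 *
        ∏ n', rowH σ xi xj n n' (fun k => θ (Sum.inl (n', k)))) ∂ initMeasure (RParam D F) =
        dot xi xj * ((Tker σ xi xj)^(D-1) * Tdot σ xi xj) := by
      intro n
      rw [integral_const_mul, integral_rows (fun t => t ^ 2) (rowH σ xi xj n), gauss_sq, one_mul,
        ← Finset.prod_erase_mul _ _ (Finset.mem_univ n)]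
      congr 2
      · rw [Finset.prod_congr rfl (g := fun _ => Tker σ xi xj)]
        · simp
        · intro n' hn'
          simp [rowH, Finset.ne_of_mem_erase hn', Tker]
      · simp [rowH, Tdot]
    simp_rw [this]
    simp
    ring
  · have := integral_rows (F := F) (D := D) (fun _ => 1)
      (fun _ u => σ (dot u xi) * σ (dot u xj))
    simpa [Tker] using this

/-- The empirical NTK at the NTK initialization of an ensemble of `M` soft rule sets of
depth `D` converges in probability, as `M → ∞`, to
`Θ^{(D,Rule)}(x_i,x_j) = D·Σ(x_i,x_j)·T(x_i,x_j)^{D−1}·Ṫ(x_i,x_j) + T(x_i,x_j)^D`. -/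
theorem stmt3 (F D : ℕ) (hF : 1 ≤ F) (hD : 1 ≤ D) (σ : ℝ → ℝ) (hσ : IsDecisionFunc σ)
    (xi xj : Fin F → ℝ) :
    ∀ ε > (0:ℝ), Tendsto
      (fun M : ℕ => initMeasure (Fin M × RParam D F)
        {θ | ε ≤ |empNTK (ruleEnsembleF σ M) θ xi xj -
          ((D : ℝ) * dot xi xj * (Tker σ xi xj)^(D-1) * Tdot σ xi xj
            + (Tker σ xi xj)^D)|})
      atTop (nhds 0) := by
  intro ε hε
  rw [← integral_ntk (D := D) σ hσ xi xj]
  set P := initMeasure (RParam D F)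
  set G : (RParam D F → ℝ) → ℝ := fun θ => empNTK (ruleF σ) θ xi xj with hG
  have hL : MemLp G 2 P := memLp_ntk σ hσ xi xj
  have hbound : ∀ M : ℕ, 1 ≤ M → initMeasure (Fin M × RParam D F)
        {θ | ε ≤ |empNTK (ruleEnsembleF σ M) θ xi xj - ∫ θ, G θ ∂P|} ≤
      ENNReal.ofReal (variance G P / ε ^ 2 / M) := by
    intro M hM
    have hM0 : (M : ℝ) ≠ 0 := by positivity
    have hL' : ∀ m : Fin M, MemLp (fun w : Fin M → RParam D F → ℝ => G (w m)) 2
        (Measure.pi fun _ => P) := fun m =>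
      hL.comp_measurePreserving (measurePreserving_eval (fun _ : Fin M => P) m)
    set S : (Fin M → RParam D F → ℝ) → ℝ := fun w => (1 / (M : ℝ)) * ∑ m, G (w m) with hS
    have hLS : MemLp S 2 (Measure.pi fun _ => P) :=
      (memLp_finset_sum _ fun m _ => hL' m).const_mul _
    have hES : ∫ w, S w ∂(Measure.pi fun _ => P) = ∫ θ, G θ ∂P := by
      rw [hS, integral_const_mul, integral_finset_sum _ fun m _ => (hL' m).integrable one_le_two]
      have : ∀ m : Fin M, ∫ w, G (w m) ∂(Measure.pi fun _ => P) = ∫ θ, G θ ∂P := fun m =>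
        integral_comp_eval hL.1
      simp_rw [this]
      simp
      field_simp
    have hVS : variance S (Measure.pi fun _ => P) = variance G P / M := by
      have h := variance_sum_pi (μ := fun _ : Fin M => P) (X := fun _ => G) (fun _ => hL)
      have h0 : S = fun w => (1 / (M : ℝ)) * (∑ m : Fin M, fun w : Fin M → RParam D F → ℝ => G (w m)) w := by
        funext w; simp [hS]
      rw [h0, variance_const_mul, h]
      simp
      field_simp
    have hc := meas_ge_le_variance_div_sq hLS hε
    rw [hES, hVS] at hc
    have hmp : MeasurePreserving (MeasurableEquiv.curry (Fin M) (RParam D F) ℝ)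
      (initMeasure (Fin M × RParam D F)) (Measure.pi fun _ => P) := mp_curry _ _
    rw [← hmp.measure_preimage_equiv] at hc
    refine le_trans (le_of_eq ?_) (hc.trans (le_of_eq ?_))
    · congr 1
      ext θ
      simp only [Set.mem_setOf_eq, Set.mem_preimage, empNTK_ens]
      rfl
    · congr 1; ring
  have hlim : Tendsto (fun M : ℕ => ENNReal.ofReal (variance G P / ε ^ 2 / M)) atTop (nhds 0) := by
    have := ENNReal.tendsto_ofReal (tendsto_const_div_atTop_nhds_zero_nat (variance G P / ε ^ 2))
    simpa using this
  exact tendsto_of_tendsto_of_tendsto_of_le_of_le' tendsto_const_nhds hlim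
    (Eventually.of_forall fun _ => zero_le)
    ((eventually_ge_atTop 1).mono hbound)

end
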